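/- Every multiplicative Hom-alternative superalgebra (i.e., both left and right Hom-alternative) is Hom-Jordan-admissible: its plus Hom-superalgebra with product x∘y = (1/2)(x*y + (-1)^{|x||y|} y*x) is a Hom-Jordan superalgebra. -/

import Mathlib

def sgn (K : Type*) [Field K] (i j : ZMod 2) : K := (-1 : K) ^ (i * j).val

def IsBilin (K : Type*) {A : Type*} [Field K] [AddCommGroup A] [Module K A]
    (f : A → A → A) : Prop :=
  (∀ (c : K) (x y : A), f (c • x) y = c • f x y) ∧
  (∀ x x' y : A, f (x + x') y = f x y + f x' y) ∧
  (∀ (c : K) (x y : A), f x (c • y) = c • f x y) ∧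
  (∀ x y y' : A, f x (y + y') = f x y + f x y')

def IsTrilin (K : Type*) {A : Type*} [Field K] [AddCommGroup A] [Module K A]
    (f : A → A → A → A) : Prop :=
  (∀ (c : K) (x y z : A), f (c • x) y z = c • f x y z) ∧
  (∀ x x' y z : A, f (x + x') y z = f x y z + f x' y z) ∧
  (∀ (c : K) (x y z : A), f x (c • y) z = c • f x y z) ∧
  (∀ x y y' z : A, f x (y + y') z = f x y z + f x y' z) ∧
  (∀ (c : K) (x y z : A), f x y (c • z) = c • f x y z) ∧
  (∀ x y z z' : A, f x y (z + z') = f x y z + f x y z')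

def asc {A : Type*} [AddCommGroup A] (mul : A → A → A) (x y z : A) : A :=
  mul (mul x y) z - mul x (mul y z)

def hasc {A : Type*} [AddCommGroup A] (mul : A → A → A) (α : A → A) (x y z : A) : A :=
  mul (mul x y) (α z) - mul (α x) (mul y z)

def br (K : Type*) {A : Type*} [Field K] [AddCommGroup A] [Module K A]
    (mul : A → A → A) (i j : ZMod 2) (x y : A) : A :=
  (2 : K)⁻¹ • (mul x y - sgn K i j • mul y x)

def jp (K : Type*) {A : Type*} [Field K] [AddCommGroup A] [Module K A]
    (mul : A → A → A) (i j : ZMod 2) (x y : A) : A :=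
  (2 : K)⁻¹ • (mul x y + sgn K i j • mul y x)

/-- The Hom-Jordan associator of the plus Hom-superalgebra, for homogeneous
arguments of degrees `da, db, dc`. -/
def hjas (K : Type*) {A : Type*} [Field K] [AddCommGroup A] [Module K A]
    (mul : A → A → A) (α : A → A) (da db dc : ZMod 2) (a b c : A) : A :=
  jp K mul (da + db) dc (jp K mul da db a b) (α c)
    - jp K mul da (db + dc) (α a) (jp K mul db dc b c)

section HomAlternative

theorem sgn_comm (K : Type*) [Field K] (i j : ZMod 2) : sgn K i j = sgn K j i := by
  rw [sgn, sgn, mul_comm]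

theorem sgn_eq_one_or (K : Type*) [Field K] (i j : ZMod 2) : sgn K i j = 1 ∨ sgn K i j = -1 :=
  neg_one_pow_eq_or K _

theorem sgn_add_right (K : Type*) [Field K] (i j k : ZMod 2) :
    sgn K i (j + k) = sgn K i j * sgn K i k := by
  have h : ∀ i j k : ZMod 2, (i * (j + k)).val % 2 = ((i * j).val + (i * k).val) % 2 := by decide
  rw [sgn, sgn, sgn, ← pow_add, neg_one_pow_eq_pow_mod_two, h, ← neg_one_pow_eq_pow_mod_two]

theorem sgn_add_left (K : Type*) [Field K] (i j k : ZMod 2) :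
    sgn K (i + j) k = sgn K i k * sgn K j k := by
  rw [sgn_comm, sgn_add_right, sgn_comm K k i, sgn_comm K k j]

variable {K A : Type*} [Field K] [AddCommGroup A] [Module K A] {mul : A → A → A} {α : A → A}

theorem IsBilin.sub_left (h : IsBilin K mul) (x x' y : A) :
    mul (x - x') y = mul x y - mul x' y := by
  have hn : x - x' = x + (-1 : K) • x' := by module
  rw [hn, h.2.1, h.1]; module

theorem IsBilin.sub_right (h : IsBilin K mul) (x y y' : A) :
    mul x (y - y') = mul x y - mul x y' := by
  have hn : y - y' = y + (-1 : K) • y' := by module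
  rw [hn, h.2.2.2, h.2.2.1]; module

theorem IsBilin.zero_left (h : IsBilin K mul) (y : A) : mul 0 y = 0 := by
  simpa using h.1 0 0 y

theorem IsBilin.zero_right (h : IsBilin K mul) (x : A) : mul x 0 = 0 := by
  simpa using h.2.2.1 0 x 0

theorem hasc_teichmuller (hbil : IsBilin K mul) (hαmul : ∀ x y : A, α (mul x y) = mul (α x) (α y))
    (w x y z : A) :
    hasc mul α (mul w x) (α y) (α z) - hasc mul α (α w) (mul x y) (α z)
        + hasc mul α (α w) (α x) (mul y z)
      = mul (α (α w)) (hasc mul α x y z) + mul (hasc mul α w x y) (α (α z)) := by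
  simp only [hasc, hbil.sub_left, hbil.sub_right, hαmul]
  abel

theorem hasc_jp (hbil : IsBilin K mul) (hαsmul : ∀ (c : K) (x : A), α (c • x) = c • α x)
    (hαadd : ∀ x y : A, α (x + y) = α x + α y) (i j : ZMod 2) (x y z t : A) :
    hasc mul α (jp K mul i j x y) z t
      = (2 : K)⁻¹ • (hasc mul α (mul x y) z t + sgn K i j • hasc mul α (mul y x) z t) := by
  simp only [hasc, jp, hbil.1, hbil.2.1, hαsmul, hαadd]
  module

variable {𝒜 : ZMod 2 → Submodule K A}

theorem jp_mem (hgr : ∀ (i j : ZMod 2) (x y : A), x ∈ 𝒜 i → y ∈ 𝒜 j → mul x y ∈ 𝒜 (i + j))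
    {i j : ZMod 2} {x y : A} (hx : x ∈ 𝒜 i) (hy : y ∈ 𝒜 j) : jp K mul i j x y ∈ 𝒜 (i + j) :=
  Submodule.smul_mem _ _ (Submodule.add_mem _ (hgr i j x y hx hy)
    (Submodule.smul_mem _ _ (add_comm j i ▸ hgr j i y x hy hx)))

variable
  (hralt : ∀ (i j k : ZMod 2) (x y z : A), x ∈ 𝒜 i → y ∈ 𝒜 j → z ∈ 𝒜 k →
    hasc mul α x y z = (-(sgn K j k)) • hasc mul α x z y)
  (hlalt : ∀ (i j k : ZMod 2) (x y z : A), x ∈ 𝒜 i → y ∈ 𝒜 j → z ∈ 𝒜 k →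
    hasc mul α x y z = (-(sgn K i j)) • hasc mul α y x z)
include hralt hlalt

theorem hasc_superflexible {i j k : ZMod 2} {x y z : A}
    (hx : x ∈ 𝒜 i) (hy : y ∈ 𝒜 j) (hz : z ∈ 𝒜 k) :
    hasc mul α x y z = (-(sgn K i j * sgn K i k * sgn K j k)) • hasc mul α z y x := by
  rw [hlalt i j k x y z hx hy hz, hralt j i k y x z hy hx hz, hlalt j k i y z x hy hz hx]
  module

/-- In a Hom-alternative superalgebra the plus Hom-associator is `-2` times the Hom-associator
plus a double supercommutator. -/
theorem four_smul_hjas (h2 : (2 : K) ≠ 0) (hbil : IsBilin K mul)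
    {i j k : ZMod 2} {x y z : A} (hx : x ∈ 𝒜 i) (hy : y ∈ 𝒜 j) (hz : z ∈ 𝒜 k) :
    (4 : K) • hjas K mul α i j k x y z
      = (-2 : K) • hasc mul α x y z
        + sgn K i j • mul (α y) (mul x z - sgn K i k • mul z x)
        - sgn K j k • mul (mul x z - sgn K i k • mul z x) (α y) := by
  have h4 : (4 : K) = 2 * 2 := by norm_num
  have hexp : (4 : K) • hjas K mul α i j k x y z
      = mul (mul x y) (α z) + sgn K i j • mul (mul y x) (α z)
        + (sgn K i k * sgn K j k) • (mul (α z) (mul x y) + sgn K i j • mul (α z) (mul y x))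
        - (mul (α x) (mul y z) + sgn K j k • mul (α x) (mul z y))
        - (sgn K i j * sgn K i k) • (mul (mul y z) (α x) + sgn K j k • mul (mul z y) (α x)) := by
    simp only [hjas, jp, hbil.1, hbil.2.1, hbil.2.2.1, hbil.2.2.2, sgn_add_left, sgn_add_right,
      h4]
    match_scalars <;> field_simp
  have e1 := hlalt i j k x y z hx hy hz
  have e2 := hralt i j k x y z hx hy hz
  have e3 := hasc_superflexible hralt hlalt hx hy hz
  have e4 := e2.trans (congrArg _ (hlalt i k j x z y hx hz hy))
  have e5 := e1.trans (congrArg _ (hralt j i k y x z hy hx hz))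
  rw [hexp]
  simp only [hasc, hbil.sub_left, hbil.sub_right, hbil.1, hbil.2.2.1] at *
  linear_combination (norm := module) -e3 + e1 + e2 + e4 + e5

omit hralt in
theorem sum_supercommutator_jp (hbil : IsBilin K mul)
    {i j l : ZMod 2} {x y t : A} (hx : x ∈ 𝒜 i) (hy : y ∈ 𝒜 j) (ht : t ∈ 𝒜 l) :
    sgn K l i • (mul (jp K mul i j x y) (α t) - sgn K (i + j) l • mul (α t) (jp K mul i j x y))
      + sgn K i j • (mul (jp K mul j l y t) (α x)
        - sgn K (j + l) i • mul (α x) (jp K mul j l y t))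
      + sgn K j l • (mul (jp K mul l i t x) (α y)
        - sgn K (l + i) j • mul (α y) (jp K mul l i t x)) = 0 := by
  have e1 := hlalt i j l x y t hx hy ht
  have e2 := hlalt j l i y t x hy ht hx
  have e3 := hlalt l i j t x y ht hx hy
  simp only [hasc, jp, hbil.1, hbil.2.1, hbil.2.2.1, hbil.2.2.2, sgn_add_left,
    sgn_comm K j i, sgn_comm K l i, sgn_comm K l j] at *
  have ha := sgn_eq_one_or K i j
  have hb := sgn_eq_one_or K i l
  have hc := sgn_eq_one_or K j l
  generalize sgn K i j = a, sgn K i l = b, sgn K j l = c at *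
  linear_combination (norm := skip) ((2 : K)⁻¹ * b) • e1 + ((2 : K)⁻¹ * a) • e2 + ((2 : K)⁻¹ * c) • e3
  match_scalars <;> grind

set_option maxHeartbeats 1000000 in
theorem sum_hasc_jp (hbil : IsBilin K mul)
    (hgr : ∀ (i j : ZMod 2) (x y : A), x ∈ 𝒜 i → y ∈ 𝒜 j → mul x y ∈ 𝒜 (i + j))
    (hαsmul : ∀ (c : K) (x : A), α (c • x) = c • α x)
    (hαadd : ∀ x y : A, α (x + y) = α x + α y)
    (hαeven : ∀ (i : ZMod 2) (x : A), x ∈ 𝒜 i → α x ∈ 𝒜 i)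
    (hαmul : ∀ x y : A, α (mul x y) = mul (α x) (α y))
    {i j k l : ZMod 2} {x y z t : A}
    (hx : x ∈ 𝒜 i) (hy : y ∈ 𝒜 j) (hz : z ∈ 𝒜 k) (ht : t ∈ 𝒜 l) :
    sgn K l (i + k) • hasc mul α (jp K mul i j x y) (α z) (α t)
      + sgn K i (j + k) • hasc mul α (jp K mul j l y t) (α z) (α x)
      + sgn K j (l + k) • hasc mul α (jp K mul l i t x) (α z) (α y) = 0 := by
  have T := hasc_teichmuller (K := K) hbil hαmul
  have flexα {i j k l : ZMod 2} {p q s : A} (hp : p ∈ 𝒜 i) (hq : q ∈ 𝒜 j) (hs : s ∈ 𝒜 l)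
      (hz : z ∈ 𝒜 k) :=
    hasc_superflexible hralt hlalt (hαeven _ _ hp) (hgr _ _ _ _ hq hz) (hαeven _ _ hs)
  have altα {i j k l : ZMod 2} {p q s : A} (hp : p ∈ 𝒜 i) (hq : q ∈ 𝒜 j) (hs : s ∈ 𝒜 l)
      (hz : z ∈ 𝒜 k) :=
    hlalt _ _ _ _ _ _ (hαeven _ _ hp) (hαeven _ _ hq) (hgr _ _ _ _ hz hs)
  have flex_mul {j k l : ZMod 2} {q s : A} (p : A) (hq : q ∈ 𝒜 j) (hs : s ∈ 𝒜 l) (hz : z ∈ 𝒜 k) :=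
    congrArg (mul (α (α p))) (hasc_superflexible hralt hlalt hq hz hs)
  have mul_alt {i j k : ZMod 2} {p q : A} (s : A) (hp : p ∈ 𝒜 i) (hq : q ∈ 𝒜 j) (hz : z ∈ 𝒜 k) :=
    congrArg (mul · (α (α s))) (hlalt _ _ _ _ _ _ hp hq hz)
  have T1 := T x y z t
  have T2 := T y x z t
  have T3 := T y t z x
  have T4 := T t y z x
  have T5 := T t x z y
  have T6 := T x t z y
  have F1 := flexα hx hy ht hz
  have F2 := flexα hy hx ht hz
  have F3 := flexα hy ht hx hz
  have L1 := altα hx hy ht hz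
  have L2 := altα hy ht hx hz
  have L3 := altα ht hx hy hz
  have M1 := flex_mul x hy ht hz
  have M2 := flex_mul y ht hx hz
  have M3 := flex_mul t hx hy hz
  have N1 := mul_alt t hx hy hz
  have N2 := mul_alt x hy ht hz
  have N3 := mul_alt y ht hx hz
  clear flexα altα flex_mul mul_alt T
  simp only [hasc_jp hbil hαsmul hαadd, sgn_add_left, sgn_add_right, hbil.1, hbil.2.2.1,
    sgn_comm K j i, sgn_comm K l i, sgn_comm K k i, sgn_comm K k j, sgn_comm K l k] at *
  have ha := sgn_eq_one_or K i j
  have hb := sgn_eq_one_or K i l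
  have hc := sgn_eq_one_or K j l
  have hd := sgn_eq_one_or K i k
  have he := sgn_eq_one_or K j k
  have hf := sgn_eq_one_or K k l
  generalize sgn K i j = a, sgn K i l = b, sgn K j l = c, sgn K i k = d, sgn K j k = e,
    sgn K k l = f at *
  linear_combination (norm := skip) ((2 : K)⁻¹ * (b * f)) • (T1 + F1 - L1 + M1 + N1)
    + ((2 : K)⁻¹ * (a * b * f)) • (T2 + F2)
    + ((2 : K)⁻¹ * (a * d)) • (T3 + F3 - L2 + M2 + N2)
    + ((2 : K)⁻¹ * (a * d * c)) • T4
    + ((2 : K)⁻¹ * (c * e)) • (T5 - L3 + M3 + N3)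
    + ((2 : K)⁻¹ * (c * e * b)) • T6
  clear hralt hlalt hgr hαsmul hαadd hαeven hαmul hbil T1 T2 T3 T4 T5 T6 F1 F2 F3 L1 L2 L3
  clear M1 M2 M3 N1 N2 N3
  match_scalars <;> grind

end HomAlternative

/-- Corollary 4.1: every multiplicative Hom-alternative superalgebra is
Hom-Jordan-admissible. -/
theorem stmt6 {K A : Type*} [Field K] [AddCommGroup A] [Module K A]
    (h2 : (2 : K) ≠ 0) (h3 : (3 : K) ≠ 0)
    (𝒜 : ZMod 2 → Submodule K A) (hds : DirectSum.IsInternal 𝒜)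
    (mul : A → A → A) (hbil : IsBilin K mul)
    (hgr : ∀ (i j : ZMod 2) (x y : A), x ∈ 𝒜 i → y ∈ 𝒜 j → mul x y ∈ 𝒜 (i + j))
    (α : A → A)
    (hαsmul : ∀ (c : K) (x : A), α (c • x) = c • α x)
    (hαadd : ∀ x y : A, α (x + y) = α x + α y)
    (hαeven : ∀ (i : ZMod 2) (x : A), x ∈ 𝒜 i → α x ∈ 𝒜 i)
    (hαmul : ∀ x y : A, α (mul x y) = mul (α x) (α y))
    (hralt : ∀ (i j k : ZMod 2) (x y z : A), x ∈ 𝒜 i → y ∈ 𝒜 j → z ∈ 𝒜 k →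
      hasc mul α x y z = (-(sgn K j k)) • hasc mul α x z y)
    (hlalt : ∀ (i j k : ZMod 2) (x y z : A), x ∈ 𝒜 i → y ∈ 𝒜 j → z ∈ 𝒜 k →
      hasc mul α x y z = (-(sgn K i j)) • hasc mul α y x z)
    (i j k l : ZMod 2) (x y z t : A)
    (hx : x ∈ 𝒜 i) (hy : y ∈ 𝒜 j) (hz : z ∈ 𝒜 k) (ht : t ∈ 𝒜 l) :
    sgn K l (i + k) • hjas K mul α (i + j) k l (jp K mul i j x y) (α z) (α t)
      + sgn K i (j + k) • hjas K mul α (j + l) k i (jp K mul j l y t) (α z) (α x)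
      + sgn K j (l + k) • hjas K mul α (l + i) k j (jp K mul l i t x) (α z) (α y) = 0 := by
  have h4 : (4 : K) ≠ 0 := by
    have : (4 : K) = 2 * 2 := by norm_num
    rw [this]; exact mul_ne_zero h2 h2
  have hz' := hαeven _ _ hz
  have H1 := four_smul_hjas hralt hlalt h2 hbil (jp_mem hgr hx hy) hz' (hαeven _ _ ht)
  have H2 := four_smul_hjas hralt hlalt h2 hbil (jp_mem hgr hy ht) hz' (hαeven _ _ hx)
  have H3 := four_smul_hjas hralt hlalt h2 hbil (jp_mem hgr ht hx) hz' (hαeven _ _ hy)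
  have S := sum_hasc_jp hralt hlalt hbil hgr hαsmul hαadd hαeven hαmul hx hy hz ht
  have C := sum_supercommutator_jp hlalt hbil hx hy ht
  have CL := congrArg (mul (α (α z))) C
  have CR := congrArg (mul · (α (α z))) C
  simp only [hbil.1, hbil.2.1, hbil.2.2.1, hbil.2.2.2, hbil.zero_left, hbil.zero_right] at CL CR
  refine (smul_eq_zero_iff_right h4).mp ?_
  simp only [sgn_add_left, sgn_add_right, sgn_comm K j i, sgn_comm K l i, sgn_comm K l j,
    sgn_comm K k i, sgn_comm K k j, sgn_comm K l k] at *
  have hd := sgn_eq_one_or K i k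
  have he := sgn_eq_one_or K j k
  have hf := sgn_eq_one_or K k l
  generalize sgn K i j = a, sgn K i l = b, sgn K j l = c, sgn K i k = d, sgn K j k = e,
    sgn K k l = f at *
  linear_combination (norm := skip) (b * f) • H1 + (a * d) • H2 + (c * e) • H3 + (-2 : K) • S
    + (d * e * f) • CL - CR
  match_scalars <;> grind
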